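/- Every positive odd integer can be written as x² + y² + 2z² with x, y, z ∈ ℤ; moreover, every positive odd integer can be written as p₈(x) + p₈(y) + 2p₈(z) with x, y, z ∈ ℤ. -/

import Mathlib

/-- A positive definite binary integral form can be brought by a unimodular substitution to one
whose leading coefficient satisfies the Hermite bound. -/
theorem exists_binary_hermite_reduction (A B C : ℤ) (hA : 0 < A) (hD : 0 < A * C - B ^ 2) :
    ∃ p q r s : ℤ, p * s - q * r = 1 ∧ 0 < A * p ^ 2 + 2 * B * p * r + C * r ^ 2 ∧
      3 * (A * p ^ 2 + 2 * B * p * r + C * r ^ 2) ^ 2 ≤ 4 * (A * C - B ^ 2) := by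
  induction hk : A.toNat using Nat.strong_induction_on generalizing A B C with
  | _ k ih =>
  obtain ⟨t, ht₁, ht₂⟩ : ∃ t : ℤ, 2 * (B + t * A) ≤ A ∧ -A ≤ 2 * (B + t * A) := by
    refine ⟨-((2 * B + A) / (2 * A)), ?_, ?_⟩
    · linarith [Int.lt_ediv_add_one_mul_self (2 * B + A) (by linarith : 0 < 2 * A)]
    · linarith [Int.ediv_mul_le (2 * B + A) (by linarith : 2 * A ≠ 0)]
  set B' := B + t * A with hB'
  set C' := C + 2 * B * t + A * t ^ 2 with hC'
  have hdet : A * C' - B' ^ 2 = A * C - B ^ 2 := by rw [hB', hC']; ring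
  have hB'sq : 4 * B' ^ 2 ≤ A ^ 2 := by nlinarith
  rcases le_or_gt A C' with h | h
  · refine ⟨1, 0, 0, 1, by ring, by linarith, ?_⟩
    nlinarith
  · have hC'pos : 0 < C' := by
      by_contra! hneg
      nlinarith [sq_nonneg B']
    obtain ⟨p, q, r, s, h₁, h₂, h₃⟩ := ih C'.toNat (by omega) C' (-B') A hC'pos
      (by linarith) rfl
    have key : A * (t * p - r) ^ 2 + 2 * B * (t * p - r) * p + C * p ^ 2
        = C' * p ^ 2 + 2 * (-B') * p * r + A * r ^ 2 := by rw [hB', hC']; ring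
    refine ⟨t * p - r, t * q - s, p, q, by linarith, by rw [key]; exact h₂, ?_⟩
    rw [key]
    linarith

/-- Every value of a positive definite binary integral form of determinant two is a value of
`v ^ 2 + 2 * w ^ 2`. -/
theorem binary_det_two_represented (A B C : ℤ) (hA : 0 < A) (hD : A * C - B ^ 2 = 2) (y z : ℤ) :
    ∃ v w : ℤ, A * y ^ 2 + 2 * B * y * z + C * z ^ 2 = v ^ 2 + 2 * w ^ 2 := by
  obtain ⟨p, q, r, s, h₁, h₂, h₃⟩ := exists_binary_hermite_reduction A B C hA (by linarith)
  set A' := A * p ^ 2 + 2 * B * p * r + C * r ^ 2 with hA'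
  have hA'1 : A' = 1 := by nlinarith
  set B' := A * p * q + B * (p * s + q * r) + C * r * s with hB'
  set C' := A * q ^ 2 + 2 * B * q * s + C * s ^ 2 with hC'
  have hdet : A' * C' - B' ^ 2 = 2 := by
    have : A' * C' - B' ^ 2 = (A * C - B ^ 2) * (p * s - q * r) ^ 2 := by
      rw [hA', hB', hC']; ring
    rw [this, hD, h₁]; norm_num
  have hval : A' * (s * y - q * z) ^ 2 + 2 * B' * (s * y - q * z) * (p * z - r * y)
      + C' * (p * z - r * y) ^ 2
      = (A * y ^ 2 + 2 * B * y * z + C * z ^ 2) * (p * s - q * r) ^ 2 := by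
    rw [hA', hB', hC']; ring
  rw [h₁, one_pow, mul_one] at hval
  rw [hA'1] at hval hdet
  refine ⟨s * y - q * z + B' * (p * z - r * y), p * z - r * y, ?_⟩
  rw [← hval]
  linear_combination (p * z - r * y) ^ 2 * hdet

/-- Every value of a positive definite ternary integral form of determinant two is a value of
`u ^ 2 + v ^ 2 + 2 * w ^ 2`. -/
theorem ternary_det_two_represented (a b c d e f : ℤ) (ha : 0 < a) (hab : 0 < a * b - d ^ 2)
    (hdet : a * b * c + 2 * d * e * f - a * f ^ 2 - b * e ^ 2 - c * d ^ 2 = 2) (x y z : ℤ) :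
    ∃ u v w : ℤ, a * x ^ 2 + b * y ^ 2 + c * z ^ 2 + 2 * d * x * y + 2 * e * x * z
      + 2 * f * y * z = u ^ 2 + v ^ 2 + 2 * w ^ 2 := by
  induction hk : a.toNat using Nat.strong_induction_on generalizing a b c d e f x y z with
  | _ k ih =>
  have hG : (a * b - d ^ 2) * (a * c - e ^ 2) - (a * f - d * e) ^ 2 = 2 * a := by
    linear_combination a * hdet
  rcases eq_or_ne a 1 with rfl | ha1
  · obtain ⟨v, w, hvw⟩ := binary_det_two_represented _ _ _ hab hG y z
    exact ⟨x + d * y + e * z, v, w, by linear_combination hvw⟩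
  obtain ⟨p, q, r, s, h₁, h₂, h₃⟩ :=
    exists_binary_hermite_reduction (a * b - d ^ 2) (a * f - d * e) (a * c - e ^ 2) hab
      (by rw [hG]; linarith)
  rw [hG] at h₃
  set d₀ := d * p + e * r with hd₀
  set b₀ := b * p ^ 2 + 2 * f * p * r + c * r ^ 2 with hb₀
  obtain ⟨t, ht₁, ht₂⟩ : ∃ t : ℤ, 2 * (d₀ + t * a) ≤ a ∧ -a ≤ 2 * (d₀ + t * a) := by
    refine ⟨-((2 * d₀ + a) / (2 * a)), ?_, ?_⟩
    · linarith [Int.lt_ediv_add_one_mul_self (2 * d₀ + a) (by linarith : 0 < 2 * a)]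
    · linarith [Int.ediv_mul_le (2 * d₀ + a) (by linarith : 2 * a ≠ 0)]
  set d' := d₀ + t * a with hd'
  set b' := b₀ + 2 * t * d₀ + t ^ 2 * a with hb'
  set e' := d * q + e * s with he'
  set c' := b * q ^ 2 + 2 * f * q * s + c * s ^ 2 with hc'
  set f' := b * p * q + f * (p * s + q * r) + c * r * s + t * e' with hf'
  have hA' : (a * b - d ^ 2) * p ^ 2 + 2 * (a * f - d * e) * p * r + (a * c - e ^ 2) * r ^ 2
      = a * b' - d' ^ 2 := by
    rw [hb', hd', hb₀, hd₀]; ring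
  rw [hA'] at h₂ h₃
  have hd'sq : 4 * d' ^ 2 ≤ a ^ 2 := by nlinarith
  have hlt : b' < a := by
    by_contra! hle
    have h3 : 3 * a ^ 2 ≤ 4 * (a * b' - d' ^ 2) := by
      linear_combination 4 * mul_le_mul_of_nonneg_left hle ha.le + hd'sq
    have h9 : (3 * a ^ 2) ^ 2 ≤ (4 * (a * b' - d' ^ 2)) ^ 2 :=
      pow_le_pow_left₀ (by positivity) h3 2
    have h27 : a * (27 * a ^ 3) ≤ a * 128 := by linear_combination 3 * h9 + 16 * h₃
    have h27' := le_of_mul_le_mul_left h27 ha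
    have h2 : 2 ≤ a := by omega
    have h8 : (2 : ℤ) ^ 3 ≤ a ^ 3 := pow_le_pow_left₀ (by norm_num) h2 3
    linarith
  have hb'pos : 0 < b' := by
    by_contra! hneg
    linarith [mul_nonpos_of_nonneg_of_nonpos ha.le hneg, sq_nonneg d']
  have hdet' : b' * a * c' + 2 * d' * f' * e' - b' * e' ^ 2 - a * f' ^ 2 - c' * d' ^ 2 = 2 := by
    have : b' * a * c' + 2 * d' * f' * e' - b' * e' ^ 2 - a * f' ^ 2 - c' * d' ^ 2
        = (a * b * c + 2 * d * e * f - a * f ^ 2 - b * e ^ 2 - c * d ^ 2)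
          * (p * s - q * r) ^ 2 := by
      rw [hf', hb', hd', hb₀, hd₀, he', hc']; ring
    rw [this, hdet, h₁]; norm_num
  obtain ⟨u, v, w, huvw⟩ := ih b'.toNat (by omega) b' a c' d' f' e' hb'pos (by linarith) hdet'
    (s * y - q * z) (x - t * (s * y - q * z)) (p * z - r * y) rfl
  refine ⟨u, v, w, ?_⟩
  rw [← huvw]
  have hy : y = p * (s * y - q * z) + q * (p * z - r * y) := by linear_combination -y * h₁
  have hz : z = r * (s * y - q * z) + s * (p * z - r * y) := by linear_combination -z * h₁
  generalize s * y - q * z = Y at *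
  generalize p * z - r * y = Z at *
  rw [hf', hb', hd', hb₀, hd₀, he', hc', hy, hz]
  ring

/-- For odd `n` there is an odd `b` such that `b * n - 2` is a prime modulo which `-b` is a
square. -/
theorem exists_prime_neg_isSquare (n : ℕ) (hn : Odd n) :
    ∃ p b : ℕ, p.Prime ∧ 0 < b ∧ p + 2 = b * n ∧ IsSquare (((-b : ℤ)) : ZMod p) := by
  obtain ⟨b₀, hb₀⟩ : ∃ b₀ : ℕ, (b₀ = 1 ∧ n % 4 = 3) ∨ (b₀ = 5 ∧ n % 4 = 1) := by
    have : n % 4 = 1 ∨ n % 4 = 3 := by obtain ⟨k, rfl⟩ := hn; omega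
    rcases this with h | h
    · exact ⟨5, Or.inr ⟨rfl, h⟩⟩
    · exact ⟨1, Or.inl ⟨rfl, h⟩⟩
  have hlarge : 2 < b₀ * n := by rcases hb₀ with ⟨rfl, h⟩ | ⟨rfl, h⟩ <;> omega
  have hodd : Odd (b₀ * n - 2) := by
    rw [Nat.odd_iff]; rcases hb₀ with ⟨rfl, h⟩ | ⟨rfl, h⟩ <;> omega
  have hcop : Nat.Coprime (b₀ * n - 2) (8 * n) := by
    refine Nat.Coprime.mul_right (Nat.Coprime.pow_right 3 hodd.coprime_two_right) ?_
    have hg : Nat.gcd (b₀ * n - 2) n ∣ 2 := by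
      have h := Nat.dvd_sub ((Nat.gcd_dvd_right (b₀ * n - 2) n).mul_left b₀)
        (Nat.gcd_dvd_left (b₀ * n - 2) n)
      rwa [Nat.sub_sub_self hlarge.le] at h
    rcases (Nat.dvd_prime Nat.prime_two).1 hg with h | h
    · exact h
    · have h2 := Nat.gcd_dvd_right (b₀ * n - 2) n
      rw [h] at h2
      exact absurd (even_iff_two_dvd.2 h2) (Nat.not_even_iff_odd.2 hn)
  have hpos : 0 < n := hn.pos
  have : NeZero (8 * n) := ⟨by omega⟩
  obtain ⟨p, hgt, hp, hmod⟩ := Nat.forall_exists_prime_gt_and_eq_mod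
    ((ZMod.isUnit_iff_coprime _ _).2 hcop) (b₀ * n)
  rw [ZMod.natCast_eq_natCast_iff] at hmod
  obtain ⟨k, hk⟩ := (Nat.modEq_iff_dvd' (by omega)).1 hmod.symm
  have hpb : p + 2 = (b₀ + 8 * k) * n := by
    have : (b₀ + 8 * k) * n = b₀ * n + 8 * n * k := by ring
    omega
  refine ⟨p, b₀ + 8 * k, hp, by omega, hpb, ?_⟩
  set b := b₀ + 8 * k with hb
  have : Fact p.Prime := ⟨hp⟩
  have hp2 : p ≠ 2 := by omega
  have hpodd : Odd p := hp.odd_of_ne_two hp2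
  have hb4 : b % 4 = 1 := by omega
  have hbodd : Odd b := by rw [Nat.odd_iff]; omega
  have hpmod : p % 4 = (n + 2) % 4 := by
    have h : (p + 2) % 4 = n % 4 := by rw [hpb, Nat.mul_mod, hb4]; simp
    omega
  have hrec : jacobiSym b p = jacobiSym (-2) b := by
    rw [jacobiSym.quadratic_reciprocity_one_mod_four hb4 hpodd]
    refine jacobiSym.mod_left' (Int.ModEq.symm ?_)
    rw [Int.modEq_iff_dvd]
    have hpb' : (p : ℤ) + 2 = b * n := by rw [← Nat.cast_mul, ← hpb]; norm_num
    exact ⟨n, by rw [← hpb']; ring⟩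
  have hone : legendreSym p (-(b : ℤ)) = 1 := by
    rw [jacobiSym.legendreSym.to_jacobiSym, jacobiSym.neg _ hpodd, hrec,
      jacobiSym.at_neg_two hbodd]
    rcases hb₀ with ⟨h, hn4⟩ | ⟨h, hn4⟩
    · rw [ZMod.χ₄_nat_one_mod_four (by omega), ZMod.χ₈'_nat_eq_if_mod_eight]
      rw [if_neg (by omega), if_pos (by omega)]; norm_num
    · rw [ZMod.χ₄_nat_three_mod_four (by omega), ZMod.χ₈'_nat_eq_if_mod_eight]
      rw [if_neg (by omega), if_neg (by omega)]; norm_num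
  refine (legendreSym.eq_one_iff p ?_).1 hone
  intro h0
  rw [(legendreSym.eq_zero_iff p _).2 h0] at hone
  exact absurd hone (by norm_num)

/-- Every positive odd integer is of the form `x ^ 2 + y ^ 2 + 2 * z ^ 2`. -/
theorem odd_eq_sq_add_sq_add_two_mul_sq (n : ℤ) (hpos : 0 < n) (hodd : Odd n) :
    ∃ x y z : ℤ, n = x ^ 2 + y ^ 2 + 2 * z ^ 2 := by
  lift n to ℕ using hpos.le
  obtain ⟨p, b, hp, hb, hpb, m, hm⟩ := exists_prime_neg_isSquare n (by exact_mod_cast hodd)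
  obtain ⟨d, rfl⟩ := ZMod.intCast_surjective m
  have hdvd : (p : ℤ) ∣ d * d + b := by
    rw [← ZMod.intCast_zmod_eq_zero_iff_dvd]
    push_cast at hm ⊢
    rw [← hm]; ring
  obtain ⟨a, ha⟩ := hdvd
  have hp0 : (0 : ℤ) < p := by exact_mod_cast hp.pos
  have hb0 : (0 : ℤ) < b := by exact_mod_cast hb
  have hpb' : (p : ℤ) + 2 = b * n := by exact_mod_cast hpb
  have ha0 : 0 < a := by
    by_contra! h
    nlinarith [mul_self_nonneg d]
  obtain ⟨u, v, w, h⟩ := ternary_det_two_represented a p n d 1 0 ha0 (by linarith)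
    (by linear_combination -(n : ℤ) * ha - hpb') 0 0 1
  exact ⟨u, v, w, by linarith⟩

/-- The square of an odd integer greater than one has a representation by
`a ^ 2 + b ^ 2 + 2 * c ^ 2` other than the obvious ones. -/
theorem exists_nontrivial_repr_sq (n : ℤ) (hn : 1 < n) (hodd : Odd n) :
    ∃ a b c : ℤ, n ^ 2 = a ^ 2 + b ^ 2 + 2 * c ^ 2 ∧ Odd a ∧ (b ≠ 0 ∨ c ≠ 0) := by
  induction hk : n.toNat using Nat.strong_induction_on generalizing n with
  | _ k ih =>
  have parity : ∀ x y z : ℤ, n = x ^ 2 + y ^ 2 + 2 * z ^ 2 → (Odd x ↔ ¬ Odd y) := by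
    intro x y z h
    rw [h] at hodd
    simp only [← Int.not_even_iff_odd, Int.even_add, Int.even_pow, Int.even_mul] at hodd ⊢
    simp at hodd
    tauto
  obtain ⟨x, y, z, h, hx, hyz⟩ :
      ∃ x y z : ℤ, n = x ^ 2 + y ^ 2 + 2 * z ^ 2 ∧ Odd x ∧ (y ≠ 0 ∨ z ≠ 0) := by
    obtain ⟨x, y, z, h, hx⟩ : ∃ x y z : ℤ, n = x ^ 2 + y ^ 2 + 2 * z ^ 2 ∧ Odd x := by
      obtain ⟨x, y, z, h⟩ := odd_eq_sq_add_sq_add_two_mul_sq n (by linarith) hodd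
      by_cases hx : Odd x
      · exact ⟨x, y, z, h, hx⟩
      · exact ⟨y, x, z, by linarith, by have := parity x y z h; tauto⟩
    by_cases hyz : y ≠ 0 ∨ z ≠ 0
    · exact ⟨x, y, z, h, hx, hyz⟩
    push Not at hyz
    obtain ⟨rfl, rfl⟩ := hyz
    have hsq : n = |x| ^ 2 := by rw [sq_abs]; linarith
    have habs : 1 < |x| := by
      by_contra! hle
      nlinarith [abs_nonneg x]
    obtain ⟨a, b, c, h', ha, hbc⟩ := ih |x|.toNat (by
      have : |x| < n := by nlinarith
      omega) |x| habs (odd_abs.2 hx) rfl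
    exact ⟨a, b, c, by rw [hsq, h'], ha, hbc⟩
  have hx0 : x ≠ 0 := by rintro rfl; simp at hx
  have hy : ¬ Odd y := (parity x y z h).1 hx
  refine ⟨x ^ 2 - y ^ 2 - 2 * z ^ 2, 2 * x * y, 2 * x * z, by rw [h]; ring, ?_, ?_⟩
  · simp only [← Int.not_even_iff_odd, Int.even_sub, Int.even_pow, Int.even_mul] at hx hy ⊢
    simp
    tauto
  · simpa [hx0] using hyz

/-- Multiplication by nine allows a nonzero value of `y ^ 2 + 2 * z ^ 2` to be represented with
both variables prime to three. -/
theorem exists_nine_mul_sq_add_two_mul_sq (y z : ℤ) (h : y ≠ 0 ∨ z ≠ 0) :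
    ∃ u v : ℤ, 9 * (y ^ 2 + 2 * z ^ 2) = u ^ 2 + 2 * v ^ 2 ∧ ¬ 3 ∣ u ∧ ¬ 3 ∣ v := by
  induction hk : y.natAbs + z.natAbs using Nat.strong_induction_on generalizing y z with
  | _ k ih =>
  have step : ∀ y z : ℤ, ¬ (3 ∣ y ∧ 3 ∣ z) →
      ∃ u v : ℤ, 9 * (y ^ 2 + 2 * z ^ 2) = u ^ 2 + 2 * v ^ 2 ∧ ¬ 3 ∣ u ∧ ¬ 3 ∣ v := by
    intro y z hyz
    by_cases hsum : 3 ∣ y + z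
    · exact ⟨y - 4 * z, 2 * y + z, by ring, by omega, by omega⟩
    · exact ⟨y + 4 * z, 2 * y - z, by ring, by omega, by omega⟩
  by_cases hyz : 3 ∣ y ∧ 3 ∣ z
  · obtain ⟨⟨y', rfl⟩, ⟨z', rfl⟩⟩ := hyz
    obtain ⟨u, v, huv, hu, hv⟩ := ih (y'.natAbs + z'.natAbs) (by omega) y' z' (by omega) rfl
    obtain ⟨u', v', huv', hu', hv'⟩ := step u v (by tauto)
    exact ⟨u', v', by rw [← huv', ← huv]; ring, hu', hv'⟩
  · exact step y z hyz

/-- A sufficiently nontrivial representation of an integer congruent to one modulo three can be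
replaced by one with all variables prime to three. -/
theorem exists_repr_not_three_dvd (N a b c : ℤ) (hN : N % 3 = 1)
    (h : N = a ^ 2 + b ^ 2 + 2 * c ^ 2) (hbc : b ≠ 0 ∨ c ≠ 0) (hac : a ≠ 0 ∨ c ≠ 0) :
    ∃ x y z : ℤ, N = x ^ 2 + y ^ 2 + 2 * z ^ 2 ∧ ¬ 3 ∣ x ∧ ¬ 3 ∣ y ∧ ¬ 3 ∣ z := by
  have sq_mod : ∀ t : ℤ, (3 ∣ t ∧ t ^ 2 % 3 = 0) ∨ (¬ 3 ∣ t ∧ t ^ 2 % 3 = 1) := by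
    intro t
    have : t % 3 = 0 ∨ t % 3 = 1 ∨ t % 3 = 2 := by omega
    rcases this with h | h | h
    · exact Or.inl ⟨by omega, by simp [pow_two, Int.mul_emod, h]⟩
    · exact Or.inr ⟨by omega, by simp [pow_two, Int.mul_emod, h]⟩
    · exact Or.inr ⟨by omega, by simp [pow_two, Int.mul_emod, h]⟩
  have fix : ∀ a b c : ℤ, N = a ^ 2 + b ^ 2 + 2 * c ^ 2 → (b ≠ 0 ∨ c ≠ 0) →
      ¬ 3 ∣ a → 3 ∣ b → 3 ∣ c →
      ∃ x y z : ℤ, N = x ^ 2 + y ^ 2 + 2 * z ^ 2 ∧ ¬ 3 ∣ x ∧ ¬ 3 ∣ y ∧ ¬ 3 ∣ z := by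
    rintro a _ _ h hbc ha ⟨b, rfl⟩ ⟨c, rfl⟩
    obtain ⟨u, v, huv, hu, hv⟩ := exists_nine_mul_sq_add_two_mul_sq b c (by omega)
    exact ⟨a, u, v, by linarith, ha, hu, hv⟩
  rcases sq_mod a with ⟨ha, ha'⟩ | ⟨ha, ha'⟩ <;> rcases sq_mod b with ⟨hb, hb'⟩ | ⟨hb, hb'⟩ <;>
    rcases sq_mod c with ⟨hc, hc'⟩ | ⟨hc, hc'⟩ <;> try omega
  · exact fix b a c (by linarith) hac hb ha hc
  · exact fix a b c h hbc ha hb hc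
  · exact ⟨a, b, c, h, ha, hb, hc⟩

theorem exists_sq_eq_three_mul_sub_one_sq (x : ℤ) (hx : ¬ 3 ∣ x) :
    ∃ t : ℤ, x ^ 2 = (3 * t - 1) ^ 2 := by
  have : x % 3 = 1 ∨ x % 3 = 2 := by omega
  rcases this with h | h
  · refine ⟨-(x / 3), ?_⟩
    have hx' : x = 3 * (x / 3) + 1 := by omega
    generalize x / 3 = q at hx' ⊢
    rw [hx']; ring
  · refine ⟨x / 3 + 1, ?_⟩
    have hx' : x = 3 * (x / 3) + 2 := by omega
    generalize x / 3 = q at hx' ⊢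
    rw [hx']; ring

theorem stmt19 (n : ℤ) (hpos : 0 < n) (hodd : Odd n) :
    (∃ x y z : ℤ, n = x ^ 2 + y ^ 2 + 2 * z ^ 2) ∧
    (∃ x y z : ℤ, n = x * (3 * x - 2) + y * (3 * y - 2) + 2 * (z * (3 * z - 2))) := by
  refine ⟨odd_eq_sq_add_sq_add_two_mul_sq n hpos hodd, ?_⟩
  have hNodd : Odd (3 * n + 4) := by
    obtain ⟨k, rfl⟩ := hodd
    exact ⟨3 * k + 3, by ring⟩
  have hNmod : (3 * n + 4) % 3 = 1 := by omega
  have of_sq : ∀ a : ℤ, 3 * n + 4 = a ^ 2 → ∃ x y z : ℤ, 3 * n + 4 = x ^ 2 + y ^ 2 + 2 * z ^ 2 ∧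
      ¬ 3 ∣ x ∧ ¬ 3 ∣ y ∧ ¬ 3 ∣ z := by
    intro a ha
    rw [← sq_abs] at ha
    have h1 : 1 < |a| := by
      by_contra! hle
      nlinarith [abs_nonneg a]
    have haodd : Odd |a| := by
      rw [ha] at hNodd
      exact (Int.odd_pow.1 hNodd).resolve_right (by norm_num)
    obtain ⟨x, y, z, h, hx, hyz⟩ := exists_nontrivial_repr_sq |a| h1 haodd
    refine exists_repr_not_three_dvd _ x y z hNmod (by rw [ha, h]) hyz (Or.inl ?_)
    rintro rfl
    simp at hx
  obtain ⟨x, y, z, h, hx, hy, hz⟩ : ∃ x y z : ℤ, 3 * n + 4 = x ^ 2 + y ^ 2 + 2 * z ^ 2 ∧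
      ¬ 3 ∣ x ∧ ¬ 3 ∣ y ∧ ¬ 3 ∣ z := by
    obtain ⟨a, b, c, h⟩ := odd_eq_sq_add_sq_add_two_mul_sq (3 * n + 4) (by linarith) hNodd
    by_cases hbc : b ≠ 0 ∨ c ≠ 0
    · by_cases hac : a ≠ 0 ∨ c ≠ 0
      · exact exists_repr_not_three_dvd _ a b c hNmod h hbc hac
      · push Not at hac
        exact of_sq b (by rw [h, hac.1, hac.2]; ring)
    · push Not at hbc
      exact of_sq a (by rw [h, hbc.1, hbc.2]; ring)
  obtain ⟨r, hr⟩ := exists_sq_eq_three_mul_sub_one_sq x hx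
  obtain ⟨s, hs⟩ := exists_sq_eq_three_mul_sub_one_sq y hy
  obtain ⟨t, ht⟩ := exists_sq_eq_three_mul_sub_one_sq z hz
  exact ⟨r, s, t, by linarith⟩
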